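/- arXiv:1610.00207 — 2 statements merged into one kernel-verified Lean document; each statement's English description precedes it below -/
import Mathlib

section
/- (Lemma A3(iii)) Under Assumption 1, if the dual vector satisfies ‖ν̂_{S^c}‖_∞ < 1, then the minimizer of L(β) + λ‖β‖₁ over ℝ^p is unique and equals α̂ (the vector that is α̂_S on S and 0 on S^c). -/
open scoped BigOperators
open Matrix

noncomputable section

/-- Logistic function `ρ(u,v) = exp(uᵀv)/(1+exp(uᵀv))`. -/
def rho {ι : Type*} [Fintype ι] (u v : ι → ℝ) : ℝ :=
  Real.exp (u ⬝ᵥ v) / (1 + Real.exp (u ⬝ᵥ v))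

/-- `w(u,v) = exp(uᵀv)/(1+exp(uᵀv))²`. -/
def wFun {ι : Type*} [Fintype ι] (u v : ι → ℝ) : ℝ :=
  Real.exp (u ⬝ᵥ v) / (1 + Real.exp (u ⬝ᵥ v)) ^ 2

/-- The ℓ1-norm of a vector. -/
def l1norm {ι : Type*} [Fintype ι] (v : ι → ℝ) : ℝ := ∑ j, |v j|

/-- The ℓ2-norm of a vector. -/
def l2norm {ι : Type*} [Fintype ι] (v : ι → ℝ) : ℝ := Real.sqrt (∑ j, (v j) ^ 2)

/-- The ℓ∞-norm of a vector. -/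
def linfNorm {ι : Type*} [Fintype ι] (v : ι → ℝ) : ℝ := ⨆ j, |v j|

/-- The ℓ∞-to-ℓ∞ operator norm of a matrix: the maximum absolute row sum. -/
def opInf {ι κ : Type*} [Fintype ι] [Fintype κ] (M : Matrix ι κ ℝ) : ℝ :=
  ⨆ i, ∑ j, |M i j|

/-- The spectral norm (ℓ2-to-ℓ2 operator norm) of a matrix. -/
def op2 {ι κ : Type*} [Fintype ι] [Fintype κ] (M : Matrix ι κ ℝ) : ℝ :=
  sSup {c : ℝ | ∃ v : κ → ℝ, l2norm v = 1 ∧ c = l2norm (M *ᵥ v)}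

/-- The smallest eigenvalue of a symmetric matrix, as the infimum of its
Rayleigh quotient over unit vectors. -/
def eigMin {ι : Type*} [Fintype ι] (M : Matrix ι ι ℝ) : ℝ :=
  sInf {c : ℝ | ∃ v : ι → ℝ, l2norm v = 1 ∧ c = v ⬝ᵥ (M *ᵥ v)}

/-- The largest eigenvalue of a symmetric matrix, as the supremum of its
Rayleigh quotient over unit vectors. -/
def eigMax {ι : Type*} [Fintype ι] (M : Matrix ι ι ℝ) : ℝ :=
  sSup {c : ℝ | ∃ v : ι → ℝ, l2norm v = 1 ∧ c = v ⬝ᵥ (M *ᵥ v)}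

/-- The negative log-likelihood of the logistic regression model,
`L(β) = (1/n)·Σᵢ [log(1+exp(xᵢᵀβ)) − yᵢ·xᵢᵀβ]`. -/
def logLoss {n : ℕ} {ι : Type*} [Fintype ι] (X : Matrix (Fin n) ι ℝ)
    (y : Fin n → ℝ) (β : ι → ℝ) : ℝ :=
  (1 / (n : ℝ)) * ∑ i, (Real.log (1 + Real.exp (X i ⬝ᵥ β)) - y i * (X i ⬝ᵥ β))

/-- The negative gradient of `logLoss X y` at `a`. -/
def score {n : ℕ} {ι : Type*} [Fintype ι] (X : Matrix (Fin n) ι ℝ)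
    (y : Fin n → ℝ) (a : ι → ℝ) (j : ι) : ℝ :=
  (1 / (n : ℝ)) * ∑ i, X i j * (y i - rho (X i) a)

/-- The Bregman gap of `t ↦ log (1 + exp t)` between `a` and `b`. -/
def softplusGap (a b : ℝ) : ℝ :=
  Real.log (1 + Real.exp b) - Real.log (1 + Real.exp a) -
    Real.exp a / (1 + Real.exp a) * (b - a)

theorem softplusGap_self (a : ℝ) : softplusGap a a = 0 := by
  simp [softplusGap]

theorem softplusGap_pos {a b : ℝ} (hab : a ≠ b) : 0 < softplusGap a b := by
  have ha : 0 < 1 + Real.exp a := by positivity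
  have hb : 0 < 1 + Real.exp b := by positivity
  have hconv := strictConvexOn_exp.2 (Set.mem_univ (b - a)) (Set.mem_univ 0)
    (sub_ne_zero.mpr hab.symm)
    (show 0 < Real.exp a / (1 + Real.exp a) by positivity)
    (show 0 < 1 / (1 + Real.exp a) by positivity) (by field_simp; ring)
  have hratio : Real.exp a / (1 + Real.exp a) * Real.exp (b - a) + 1 / (1 + Real.exp a) =
      (1 + Real.exp b) / (1 + Real.exp a) := by
    rw [Real.exp_sub]
    field_simp
    ring
  simp only [smul_eq_mul, mul_zero, add_zero, Real.exp_zero, mul_one] at hconv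
  rw [hratio, ← Real.lt_log_iff_exp_lt (by positivity), Real.log_div hb.ne' ha.ne'] at hconv
  unfold softplusGap
  linarith

theorem softplusGap_nonneg (a b : ℝ) : 0 ≤ softplusGap a b := by
  rcases eq_or_ne a b with rfl | hab
  · rw [softplusGap_self]
  · exact (softplusGap_pos hab).le

theorem sum_score_mul {n : ℕ} {ι : Type*} [Fintype ι] (X : Matrix (Fin n) ι ℝ)
    (y : Fin n → ℝ) (a d : ι → ℝ) :
    ∑ j, score X y a j * d j =
      (1 / (n : ℝ)) * ∑ i, (y i - rho (X i) a) * (X i ⬝ᵥ d) := by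
  simp only [score, dotProduct, Finset.mul_sum, Finset.sum_mul]
  rw [Finset.sum_comm]
  refine Finset.sum_congr rfl fun i _ => Finset.sum_congr rfl fun j _ => ?_
  ring

theorem logLoss_sub_logLoss {n : ℕ} {ι : Type*} [Fintype ι] (X : Matrix (Fin n) ι ℝ)
    (y : Fin n → ℝ) (a b : ι → ℝ) :
    logLoss X y b - logLoss X y a =
      (1 / (n : ℝ)) * ∑ i, softplusGap (X i ⬝ᵥ a) (X i ⬝ᵥ b) -
        ∑ j, score X y a j * (b j - a j) := by
  have h := sum_score_mul X y a (b - a)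
  simp only [Pi.sub_apply] at h
  rw [h, logLoss, logLoss, ← mul_sub, ← mul_sub, ← Finset.sum_sub_distrib,
    ← Finset.sum_sub_distrib]
  congr 1
  refine Finset.sum_congr rfl fun i _ => ?_
  rw [dotProduct_sub, softplusGap, rho]
  ring

theorem hasDerivAt_log_one_add_exp (t : ℝ) :
    HasDerivAt (fun t => Real.log (1 + Real.exp t)) (Real.exp t / (1 + Real.exp t)) t :=
  ((Real.hasDerivAt_exp t).const_add 1).log (by positivity)

theorem hasDerivAt_logLoss_line {n : ℕ} {ι : Type*} [Fintype ι] (X : Matrix (Fin n) ι ℝ)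
    (y : Fin n → ℝ) (a d : ι → ℝ) :
    HasDerivAt (fun t : ℝ => logLoss X y (a + t • d)) (-∑ j, score X y a j * d j) 0 := by
  have hline (i : Fin n) : HasDerivAt (fun t : ℝ => X i ⬝ᵥ (a + t • d)) (X i ⬝ᵥ d) 0 := by
    simp only [dotProduct_add, dotProduct_smul, smul_eq_mul]
    simpa using ((hasDerivAt_id (0 : ℝ)).mul_const (X i ⬝ᵥ d)).const_add (X i ⬝ᵥ a)
  have hterm (i : Fin n) := ((hasDerivAt_log_one_add_exp _).comp (0 : ℝ) (hline i)).sub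
    ((hline i).const_mul (y i))
  have hsum := (HasDerivAt.fun_sum fun i (_ : i ∈ Finset.univ) => hterm i).const_mul
    (1 / (n : ℝ))
  refine hsum.congr_deriv ?_
  rw [sum_score_mul, ← mul_neg, ← Finset.sum_neg_distrib]
  congr 1
  refine Finset.sum_congr rfl fun i _ => ?_
  simp only [zero_smul, add_zero, rho]
  ring

theorem l1norm_line_le {ι : Type*} [Fintype ι] (a b : ι → ℝ) {t : ℝ} (ht0 : 0 ≤ t)
    (ht1 : t ≤ 1) :
    l1norm (a + t • (b - a)) ≤ l1norm a + t * (l1norm b - l1norm a) := by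
  simp only [l1norm, ← Finset.sum_sub_distrib, Finset.mul_sum, ← Finset.sum_add_distrib]
  refine Finset.sum_le_sum fun j _ => ?_
  simp only [Pi.add_apply, Pi.smul_apply, Pi.sub_apply, smul_eq_mul]
  calc |a j + t * (b j - a j)| = |(1 - t) * a j + t * b j| := by ring_nf
    _ ≤ |(1 - t) * a j| + |t * b j| := abs_add_le _ _
    _ = |a j| + t * (|b j| - |a j|) := by
      rw [abs_mul, abs_mul, abs_of_nonneg ht0, abs_of_nonneg (sub_nonneg.mpr ht1)]
      ring

/-- First-order optimality of a minimizer of the `ℓ1`-penalized logistic loss. -/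
theorem sum_score_mul_sub_le {n : ℕ} {ι : Type*} [Fintype ι] (X : Matrix (Fin n) ι ℝ)
    (y : Fin n → ℝ) {lam : ℝ} (hlam : 0 < lam) {a : ι → ℝ}
    (hmin : ∀ θ, logLoss X y a + lam * l1norm a ≤ logLoss X y θ + lam * l1norm θ)
    (b : ι → ℝ) :
    ∑ j, score X y a j * (b j - a j) ≤ lam * (l1norm b - l1norm a) := by
  have hderiv := (hasDerivAt_logLoss_line X y a (b - a)).add
    ((hasDerivAt_id (0 : ℝ)).mul_const (lam * (l1norm b - l1norm a)))
  have hlim := hderiv.tendsto_slope_zero_right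
  have hnonneg := ge_of_tendsto hlim (b := 0) (by
    filter_upwards [Ioc_mem_nhdsGT (zero_lt_one' ℝ)] with t ht
    have hle := hmin (a + t • (b - a))
    have hnorm := mul_le_mul_of_nonneg_left (l1norm_line_le a b ht.1.le ht.2) hlam.le
    refine smul_nonneg (inv_nonneg.mpr ht.1.le) ?_
    simp only [Pi.add_apply, id, zero_add, zero_smul, add_zero, zero_mul]
    linarith)
  simp only [Pi.sub_apply, one_mul] at hnonneg
  linarith

/-- If `c • (A * B)` has positive smallest eigenvalue, then `B` has trivial kernel. -/
theorem eq_zero_of_mulVec_eq_zero_of_eigMin_pos {m ι : Type*} [Fintype m] [Fintype ι]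
    {A : Matrix ι m ℝ} {B : Matrix m ι ℝ} {c : ℝ} (hpos : 0 < eigMin (c • (A * B)))
    {d : ι → ℝ} (hd : B *ᵥ d = 0) : d = 0 := by
  by_contra hne
  obtain ⟨k, hk⟩ := Function.ne_iff.mp hne
  have hsum : 0 < ∑ j, d j ^ 2 :=
    Finset.sum_pos' (fun j _ => sq_nonneg _) ⟨k, Finset.mem_univ k, by
      have : d k ≠ 0 := hk
      positivity⟩
  refine hpos.not_ge (Real.sInf_nonpos' ⟨0, ⟨(Real.sqrt (∑ j, d j ^ 2))⁻¹ • d, ?_, ?_⟩, le_rfl⟩)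
  · simp only [l2norm, Pi.smul_apply, smul_eq_mul, mul_pow, ← Finset.mul_sum, inv_pow,
      Real.sq_sqrt hsum.le]
    rw [inv_mul_cancel₀ hsum.ne', Real.sqrt_one]
  · simp [Matrix.smul_mulVec, Matrix.mulVec_smul, ← Matrix.mulVec_mulVec, hd]

theorem dual_strict_unique
    (n p : ℕ) (X : Matrix (Fin n) (Fin p) ℝ) (y : Fin n → ℝ)
    (hy : ∀ i, y i = 0 ∨ y i = 1)
    (c_b : ℝ) (hcb : 0 < c_b) (hXb : ∀ i j, |X i j| ≤ c_b)
    (βs : Fin p → ℝ) (S : Finset (Fin p)) (hS : ∀ j, j ∈ S ↔ βs j ≠ 0)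
    (s : ℕ) (hs : s = S.card)
    (W : Matrix (Fin n) (Fin n) ℝ)
    (hW : W = Matrix.diagonal fun i => wFun (X i) βs)
    (XS : Matrix (Fin n) {j // j ∈ S} ℝ) (hXS : ∀ i j, XS i j = X i j.1)
    (cmin : ℝ) (hcmin : cmin = eigMin ((1 / (n : ℝ)) • (XSᵀ * W * XS)))
    (hA1 : 0 < cmin)
    (lam : ℝ) (hlam : 0 < lam)
    (αS : {j // j ∈ S} → ℝ)
    (hαS : ∀ θ : {j // j ∈ S} → ℝ,
      logLoss XS y αS + lam * l1norm αS ≤ logLoss XS y θ + lam * l1norm θ)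
    (αhat : Fin p → ℝ)
    (hαhat : ∀ j : Fin p, αhat j = if h : j ∈ S then αS ⟨j, h⟩ else 0)
    (ν : Fin p → ℝ)
    (hν : ∀ j, ν j = (1 / ((n : ℝ) * lam)) * ∑ i, X i j * (y i - rho (X i) αhat))
    (hdual : linfNorm (fun j : {j // j ∉ S} => ν j.1) < 1) :
    (∀ β : Fin p → ℝ,
        logLoss X y αhat + lam * l1norm αhat ≤ logLoss X y β + lam * l1norm β) ∧
      ∀ βh : Fin p → ℝ,
        (∀ β : Fin p → ℝ,
          logLoss X y βh + lam * l1norm βh ≤ logLoss X y β + lam * l1norm β) →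
        βh = αhat := by
  have hXβ (β : Fin p → ℝ) (hβ : ∀ j, j ∉ S → β j = 0) (i : Fin n) :
      X i ⬝ᵥ β = XS i ⬝ᵥ fun j => β j.1 := by
    simp only [dotProduct, hXS]
    rw [Finset.sum_coe_sort S fun j => X i j * β j]
    exact (Finset.sum_subset (Finset.subset_univ S) fun j _ hj => by simp [hβ j hj]).symm
  have hα_off (j : Fin p) (hj : j ∉ S) : αhat j = 0 := by simp [hαhat, hj]
  have hα_on : (fun j : {j // j ∈ S} => αhat j.1) = αS := by
    funext j
    simp [hαhat]
  have hν_score (j : Fin p) : score X y αhat j = lam * ν j := by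
    rw [hν, score, ← mul_assoc]
    congr 1
    field_simp
  have hscore_on (j : {j // j ∈ S}) : score XS y αS j = lam * ν j.1 := by
    rw [← hν_score, score, score]
    simp only [rho, hXβ αhat hα_off, hα_on, hXS]
  have hν_lt (j : Fin p) (hj : j ∉ S) : |ν j| < 1 :=
    (le_ciSup (f := fun j : {j // j ∉ S} => |ν j.1|) (Set.finite_range _).bddAbove
      ⟨j, hj⟩).trans_lt hdual
  have hsplit (f : Fin p → ℝ) : ∑ j, f j = ∑ j : {j // j ∈ S}, f j.1 + ∑ j ∈ Sᶜ, f j := by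
    rw [Finset.sum_coe_sort S f, Finset.sum_add_sum_compl]
  have hoff_nonneg (β : Fin p → ℝ) (j : Fin p) (hj : j ∈ Sᶜ) : 0 ≤ |β j| - ν j * β j := by
    have h1 := le_abs_self (ν j * β j)
    rw [abs_mul] at h1
    nlinarith [abs_nonneg (β j), hν_lt j (Finset.mem_compl.mp hj)]
  have hgap_nonneg (β : Fin p → ℝ) :
      0 ≤ (1 / (n : ℝ)) * ∑ i, softplusGap (X i ⬝ᵥ αhat) (X i ⬝ᵥ β) :=
    mul_nonneg (by positivity) (Finset.sum_nonneg fun i _ => softplusGap_nonneg _ _)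
  have hlower (β : Fin p → ℝ) :
      (1 / (n : ℝ)) * ∑ i, softplusGap (X i ⬝ᵥ αhat) (X i ⬝ᵥ β) +
          lam * ∑ j ∈ Sᶜ, (|β j| - ν j * β j) ≤
        (logLoss X y β + lam * l1norm β) - (logLoss X y αhat + lam * l1norm αhat) := by
    have hloss := logLoss_sub_logLoss X y αhat β
    have hkkt := sum_score_mul_sub_le XS y hlam hαS fun j => β j.1
    simp only [hν_score] at hloss
    simp only [hscore_on] at hkkt
    have hα_norm : l1norm αhat = l1norm αS := by
      rw [l1norm, hsplit, ← hα_on, l1norm, add_eq_left]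
      exact Finset.sum_eq_zero fun j hj => by simp [hα_off j (Finset.mem_compl.mp hj)]
    have hβ_norm : l1norm β = l1norm (fun j : {j // j ∈ S} => β j.1) + ∑ j ∈ Sᶜ, |β j| :=
      hsplit _
    have hoff : ∑ j ∈ Sᶜ, lam * ν j * (β j - αhat j) = lam * ∑ j ∈ Sᶜ, ν j * β j := by
      rw [Finset.mul_sum]
      refine Finset.sum_congr rfl fun j hj => ?_
      rw [hα_off j (Finset.mem_compl.mp hj)]
      ring
    rw [hsplit, hoff] at hloss
    simp only [← hα_on] at hkkt hα_norm
    rw [hα_norm, hβ_norm, Finset.sum_sub_distrib]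
    linarith
  refine ⟨fun β => ?_, fun β hβ => ?_⟩
  · have := hlower β
    have := hgap_nonneg β
    have := mul_nonneg hlam.le (Finset.sum_nonneg (hoff_nonneg β))
    linarith
  · have hle := hlower β
    have hαβ := hβ αhat
    have hgap := hgap_nonneg β
    have hoff := mul_nonneg hlam.le (Finset.sum_nonneg (hoff_nonneg β))
    have hoff_zero : ∑ j ∈ Sᶜ, (|β j| - ν j * β j) = 0 :=
      (mul_eq_zero.mp (show lam * _ = 0 by linarith)).resolve_left hlam.ne'
    have hgap_zero : (1 / (n : ℝ)) * ∑ i, softplusGap (X i ⬝ᵥ αhat) (X i ⬝ᵥ β) = 0 := by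
      linarith
    have hβ_off (j : Fin p) (hj : j ∉ S) : β j = 0 := by
      have h0 := (Finset.sum_eq_zero_iff_of_nonneg (hoff_nonneg β)).mp hoff_zero j
        (Finset.mem_compl.mpr hj)
      have h1 := le_abs_self (ν j * β j)
      rw [abs_mul] at h1
      by_contra hne
      nlinarith [abs_pos.mpr hne, hν_lt j hj]
    have hfit (i : Fin n) : X i ⬝ᵥ αhat = X i ⬝ᵥ β := by
      have hn : (1 / (n : ℝ)) ≠ 0 :=
        one_div_ne_zero (Nat.cast_ne_zero.mpr (Nat.ne_zero_of_lt i.isLt))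
      have h0 := (Finset.sum_eq_zero_iff_of_nonneg
        fun i _ => softplusGap_nonneg (X i ⬝ᵥ αhat) (X i ⬝ᵥ β)).mp
        ((mul_eq_zero.mp hgap_zero).resolve_left hn) i (Finset.mem_univ i)
      by_contra hne
      exact (softplusGap_pos hne).ne' h0
    rw [hcmin] at hA1
    have hd := eq_zero_of_mulVec_eq_zero_of_eigMin_pos hA1
      (d := (fun j : {j // j ∈ S} => β j.1) - fun j => αhat j.1) (by
        funext i
        rw [Matrix.mulVec, dotProduct_sub, ← hXβ β hβ_off, ← hXβ αhat hα_off, hfit i]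
        simp)
    funext j
    by_cases hj : j ∈ S
    · exact sub_eq_zero.mp (congrFun hd ⟨j, hj⟩)
    · rw [hβ_off j hj, hα_off j hj]
end
end

section
/- Let L : ℝ^p → ℝ be a convex differentiable function and λ > 0. Suppose α ∈ ℝ^p minimizes L(β) + λ‖β‖₁ over ℝ^p, and set ν = −∇L(α)/λ. If ν ∈ ∂‖α‖₁ (i.e., ‖ν‖_∞ ≤ 1 and ν_j = sign(α_j) whenever α_j ≠ 0), then every minimizer β̂ of L(β) + λ‖β‖₁ satisfies ‖β̂‖₁ = ⟨ν, β̂⟩; in particular, β̂_j = 0 for every coordinate j with |ν_j| < 1. -/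
open scoped BigOperators
open Matrix

noncomputable section

/-- A convex function lies above its tangent hyperplane. -/
theorem ConvexOn.add_fderiv_sub_le {E : Type*} [NormedAddCommGroup E] [NormedSpace ℝ E]
    {f : E → ℝ} (hf : ConvexOn ℝ Set.univ f) {x : E} (hx : DifferentiableAt ℝ f x) (y : E) :
    f x + fderiv ℝ f x (y - x) ≤ f y := by
  have hline : ConvexOn ℝ Set.univ (f ∘ AffineMap.lineMap (k := ℝ) x y) := by
    simpa using hf.comp_affineMap (AffineMap.lineMap (k := ℝ) x y)
  have hderiv : HasDerivAt (f ∘ AffineMap.lineMap (k := ℝ) x y) (fderiv ℝ f x (y - x)) 0 := by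
    refine HasFDerivAt.comp_hasDerivAt (0 : ℝ) ?_ AffineMap.hasDerivAt_lineMap
    simpa using hx.hasFDerivAt
  have hslope := hline.le_slope_of_hasDerivAt (Set.mem_univ 0) (Set.mem_univ 1) one_pos hderiv
  simp only [slope_def_field, Function.comp_apply, AffineMap.lineMap_apply_zero,
    AffineMap.lineMap_apply_one, sub_zero, div_one] at hslope
  linarith

theorem ContinuousLinearMap.apply_eq_sum_single {ι : Type*} [Fintype ι] [DecidableEq ι]
    (φ : (ι → ℝ) →L[ℝ] ℝ) (v : ι → ℝ) : φ v = ∑ j, φ (Pi.single j 1) * v j := by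
  conv_lhs => rw [pi_eq_sum_univ' v, map_sum]
  refine Finset.sum_congr rfl fun j _ => ?_
  rw [map_smul, smul_eq_mul, mul_comm]

theorem abs_le_linfNorm {ι : Type*} [Fintype ι] (v : ι → ℝ) (j : ι) : |v j| ≤ linfNorm v :=
  le_ciSup (Set.finite_range fun j => |v j|).bddAbove j

theorem mul_le_abs_of_abs_le_one {a b : ℝ} (ha : |a| ≤ 1) : a * b ≤ |b| :=
  calc a * b ≤ |a| * |b| := (le_abs_self _).trans (abs_mul a b).le
    _ ≤ |b| := mul_le_of_le_one_left (abs_nonneg b) ha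

theorem l1_subgradient_minimizers
    (p : ℕ) (L : (Fin p → ℝ) → ℝ)
    (hconv : ConvexOn ℝ Set.univ L) (hdiff : Differentiable ℝ L)
    (lam : ℝ) (hlam : 0 < lam)
    (α : Fin p → ℝ)
    (hα : ∀ β : Fin p → ℝ, L α + lam * l1norm α ≤ L β + lam * l1norm β)
    (ν : Fin p → ℝ)
    (hν : ∀ j, ν j = -(fderiv ℝ L α (Pi.single j 1)) / lam)
    (hsub : linfNorm ν ≤ 1 ∧ ∀ j, α j ≠ 0 → ν j = Real.sign (α j)) :
    ∀ βh : Fin p → ℝ,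
      (∀ β : Fin p → ℝ, L βh + lam * l1norm βh ≤ L β + lam * l1norm β) →
      l1norm βh = ∑ j, ν j * βh j ∧ ∀ j, |ν j| < 1 → βh j = 0 := by
  intro βh hβh
  have hν_le (j : Fin p) : |ν j| ≤ 1 := (abs_le_linfNorm ν j).trans hsub.1
  have hα_norm : l1norm α = ∑ j, ν j * α j := by
    refine Finset.sum_congr rfl fun j _ => ?_
    by_cases hj : α j = 0
    · simp [hj]
    · rw [hsub.2 j hj]
      rcases lt_or_gt_of_ne hj with hneg | hpos
      · rw [Real.sign_of_neg hneg, abs_of_neg hneg, neg_one_mul]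
      · rw [Real.sign_of_pos hpos, abs_of_pos hpos, one_mul]
  have hgrad : fderiv ℝ L α (βh - α) = lam * (∑ j, ν j * α j - ∑ j, ν j * βh j) := by
    rw [ContinuousLinearMap.apply_eq_sum_single, ← Finset.sum_sub_distrib, Finset.mul_sum]
    refine Finset.sum_congr rfl fun j _ => ?_
    rw [hν j, Pi.sub_apply]
    field_simp
    ring
  have hle : l1norm βh ≤ ∑ j, ν j * βh j := by
    have htangent := hconv.add_fderiv_sub_le (hdiff α) βh
    have hmin := hβh α
    rw [hgrad] at htangent
    rw [hα_norm] at hmin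
    refine le_of_mul_le_mul_left ?_ hlam
    linarith
  have hterm (j : Fin p) : ν j * βh j ≤ |βh j| := mul_le_abs_of_abs_le_one (hν_le j)
  have heq : l1norm βh = ∑ j, ν j * βh j :=
    le_antisymm hle (Finset.sum_le_sum fun j _ => hterm j)
  refine ⟨heq, fun j hj => ?_⟩
  have hj_eq : ν j * βh j = |βh j| :=
    (Finset.sum_eq_sum_iff_of_le fun i _ => hterm i).1 heq.symm j (Finset.mem_univ j)
  by_contra hne
  have hpos : 0 < |βh j| := abs_pos.2 hne
  have hlt : |ν j| * |βh j| < |βh j| := mul_lt_of_lt_one_left hpos hj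
  exact absurd hj_eq (((le_abs_self _).trans (abs_mul _ _).le).trans_lt hlt).ne
end
end
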